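/- Let H be a finite-dimensional Hopf algebra over a field k with a left integral Λ and a right cointegral λ such that λ(Λ) = 1. On H* consider the convolution product φ*ψ := (φ⊗ψ)∘Δ (so (φ*ψ)(x) = Σ φ(x₍₁₎)ψ(x₍₂₎)) with unit ε, and the bilinear form κ(φ,ψ) := (φ*ψ)(Λ) = Σ φ(Λ₍₁₎)ψ(Λ₍₂₎). Then κ is invariant, i.e. κ(φ*ψ, χ) = κ(φ, ψ*χ) for all φ, ψ, χ ∈ H*, and κ is nondegenerate; hence the convolution algebra H* together with the linear functional φ ↦ φ(Λ) is a Frobenius algebra over k. -/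

import Mathlib

open scoped TensorProduct

/-- The convolution product on `H* = Hom_k(H, k)`:
`(φ * ψ)(x) = Σ φ(x₍₁₎) · ψ(x₍₂₎)`. -/
noncomputable def conv (k H : Type) [Field k] [Ring H] [HopfAlgebra k H]
    (φ ψ : H →ₗ[k] k) : H →ₗ[k] k :=
  LinearMap.mul' k k ∘ₗ TensorProduct.map φ ψ ∘ₗ Coalgebra.comul (R := k)

open Coalgebra HopfAlgebra in
/-- The identity `Σ S(h₍₁₎) h₍₂₎ ⊗ h₍₃₎ = 1 ⊗ h`, multiplied on the right by an arbitrary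
tensor `t`. -/
theorem sum_antipode_tmul_one_mul_comul {k H : Type} [Field k] [Ring H] [HopfAlgebra k H]
    (h : H) {ι : Type*} (r : Coalgebra.Repr k h ι) :
    ∑ i ∈ r.index, (antipode k (r.left i) ⊗ₜ[k] (1 : H)) * comul (R := k) (r.right i)
      = (1 : H) ⊗ₜ[k] h := by
  let M : (H ⊗[k] H) ⊗[k] H →ₗ[k] H ⊗[k] H :=
    (LinearMap.mul' k H ∘ₗ (antipode k).rTensor H).rTensor H
  have hM : ∀ (a : H) (t : H ⊗[k] H),
      M ((TensorProduct.assoc k H H H).symm (a ⊗ₜ t)) = (antipode k a ⊗ₜ[k] (1 : H)) * t := by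
    intro a t
    induction t with
    | zero => simp
    | add x y hx hy => rw [TensorProduct.tmul_add, map_add, map_add, hx, hy, mul_add]
    | tmul b c => simp [M]
  have hco := congrArg M (Coalgebra.coassoc_symm_apply (R := k) h)
  have hl : M ((comul (R := k)).rTensor H (comul h)) = (1 : H) ⊗ₜ[k] h := by
    rw [← LinearMap.comp_apply, ← LinearMap.rTensor_comp, LinearMap.comp_assoc,
      mul_antipode_rTensor_comul, LinearMap.rTensor_comp, LinearMap.comp_apply,
      Coalgebra.rTensor_counit_comul]
    simp
  rw [hl, ← r.eq] at hco
  simpa [hM] using hco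

open Coalgebra HopfAlgebra in
/-- A left integral `Λ` satisfies `Σ S(h) Λ₍₁₎ ⊗ Λ₍₂₎ = Σ Λ₍₁₎ ⊗ h Λ₍₂₎`. -/
theorem antipode_tmul_one_mul_comul_integral {k H : Type} [Field k] [Ring H] [HopfAlgebra k H]
    {Λ : H} (hΛ : ∀ h : H, h * Λ = counit (R := k) h • Λ) (h : H) :
    (antipode k h ⊗ₜ[k] (1 : H)) * comul (R := k) Λ
      = ((1 : H) ⊗ₜ[k] h) * comul (R := k) Λ := by
  have hr : ∑ i ∈ (ℛ k h).index, counit (R := k) ((ℛ k h).right i) • (ℛ k h).left i = h := by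
    simpa only [map_sum, TensorProduct.rid_tmul, one_smul] using congrArg (TensorProduct.rid k H)
      (Coalgebra.sum_tmul_counit_eq (ℛ k h))
  rw [← sum_antipode_tmul_one_mul_comul h (ℛ k h), Finset.sum_mul]
  simp_rw [mul_assoc, ← Bialgebra.comul_mul, hΛ, map_smul, mul_smul_comm]
  conv_lhs => rw [← hr]
  simp only [map_sum, map_smul, TensorProduct.sum_tmul, Finset.sum_mul,
    ← TensorProduct.smul_tmul', smul_mul_assoc]

open Coalgebra HopfAlgebra in
/-- Every functional `ψ` is recovered from the form `κ` by `ψ(h) = κ(lam(S(h) ·), ψ)`. -/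
theorem conv_cointegral_mulLeft_antipode {k H : Type} [Field k] [Ring H] [HopfAlgebra k H]
    {Λ : H} (hΛ : ∀ h : H, h * Λ = counit (R := k) h • Λ) {lam : H →ₗ[k] k}
    (hlam : ∀ h : H,
      TensorProduct.lift ((LinearMap.lsmul k H).comp lam) (comul (R := k) h) = lam h • (1 : H))
    (hnorm : lam Λ = 1) (ψ : H →ₗ[k] k) (h : H) :
    conv k H (lam ∘ₗ LinearMap.mulLeft k (antipode k h)) ψ Λ = ψ h := by
  let E : H ⊗[k] H →ₗ[k] H := TensorProduct.lift ((LinearMap.lsmul k H).comp lam)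
  have hleft : ∀ t : H ⊗[k] H,
      LinearMap.mul' k k (TensorProduct.map (lam ∘ₗ LinearMap.mulLeft k (antipode k h)) ψ t)
        = ψ (E ((antipode k h ⊗ₜ[k] (1 : H)) * t)) := by
    intro t
    induction t with
    | zero => simp
    | add x y hx hy => simp only [mul_add, map_add, hx, hy]
    | tmul a b => simp [E]
  have hright : ∀ t : H ⊗[k] H, E (((1 : H) ⊗ₜ[k] h) * t) = h * E t := by
    intro t
    induction t with
    | zero => simp
    | add x y hx hy => simp only [mul_add, map_add, hx, hy]
    | tmul a b => simp [E]
  change LinearMap.mul' k k (TensorProduct.map _ ψ (comul (R := k) Λ)) = ψ h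
  rw [hleft, antipode_tmul_one_mul_comul_integral hΛ, hright]
  simp [E, hlam, hnorm]

/-- The convolution product `conv` is the one underlying Mathlib's convolution algebra. -/
theorem conv_eq_ofConv_mul {k H : Type} [Field k] [Ring H] [HopfAlgebra k H]
    (φ ψ : H →ₗ[k] k) :
    conv k H φ ψ = (WithConv.toConv φ * WithConv.toConv ψ).ofConv := rfl

theorem conv_assoc {k H : Type} [Field k] [Ring H] [HopfAlgebra k H] (φ ψ χ : H →ₗ[k] k) :
    conv k H (conv k H φ ψ) χ = conv k H φ (conv k H ψ χ) :=
  congrArg WithConv.ofConv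
    (mul_assoc (WithConv.toConv φ) (WithConv.toConv ψ) (WithConv.toConv χ))

/-- The form `κ(φ, ψ) = (φ * ψ)(Λ)` as a bilinear map. -/
noncomputable def convForm (k : Type) {H : Type} [Field k] [Ring H] [HopfAlgebra k H] (Λ : H) :
    (H →ₗ[k] k) →ₗ[k] (H →ₗ[k] k) →ₗ[k] k :=
  LinearMap.mk₂ k (fun φ ψ => conv k H φ ψ Λ)
    (fun φ φ' ψ => by simp [conv, TensorProduct.map_add_left])
    (fun c φ ψ => by simp [conv, TensorProduct.map_smul_left])
    (fun φ ψ ψ' => by simp [conv, TensorProduct.map_add_right])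
    (fun c φ ψ => by simp [conv, TensorProduct.map_smul_right])

/-- For a finite-dimensional Hopf algebra `H` with left integral `Λ` and right
cointegral `lam` normalized by `lam Λ = 1`, the convolution algebra `H*` (with unit the counit)
together with the bilinear form `κ(φ,ψ) = (φ*ψ)(Λ)` is a Frobenius algebra: the convolution is
associative and unital, and `κ` is invariant and nondegenerate. -/
theorem dual_convolution_frobenius
    (k H : Type) [Field k] [Ring H] [HopfAlgebra k H] [FiniteDimensional k H]
    (Λ : H) (hΛ : ∀ h : H, h * Λ = Coalgebra.counit (R := k) h • Λ)
    (lam : H →ₗ[k] k)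
    (hlam : ∀ h : H,
      TensorProduct.lift ((LinearMap.lsmul k H).comp lam) (Coalgebra.comul (R := k) h)
        = lam h • (1 : H))
    (hnorm : lam Λ = 1) :
    (∀ φ ψ χ : H →ₗ[k] k, conv k H (conv k H φ ψ) χ = conv k H φ (conv k H ψ χ)) ∧
    (∀ φ : H →ₗ[k] k, conv k H (Coalgebra.counit (R := k)) φ = φ) ∧
    (∀ φ : H →ₗ[k] k, conv k H φ (Coalgebra.counit (R := k)) = φ) ∧
    (∀ φ ψ χ : H →ₗ[k] k, conv k H (conv k H φ ψ) χ Λ = conv k H φ (conv k H ψ χ) Λ) ∧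
    (∀ φ : H →ₗ[k] k, (∀ ψ : H →ₗ[k] k, conv k H φ ψ Λ = 0) → φ = 0) ∧
    (∀ ψ : H →ₗ[k] k, (∀ φ : H →ₗ[k] k, conv k H φ ψ Λ = 0) → ψ = 0) := by
  have hright : ∀ ψ : H →ₗ[k] k, (∀ φ : H →ₗ[k] k, conv k H φ ψ Λ = 0) → ψ = 0 := by
    intro ψ hψ
    ext h
    rw [← conv_cointegral_mulLeft_antipode hΛ hlam hnorm ψ h, hψ, LinearMap.zero_apply]
  refine ⟨conv_assoc, fun φ => ?_, fun φ => ?_, fun φ ψ χ => by rw [conv_assoc], ?_, hright⟩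
  · exact congrArg WithConv.ofConv (one_mul (WithConv.toConv φ))
  · exact congrArg WithConv.ofConv (mul_one (WithConv.toConv φ))
  · have hsep : (convForm k Λ).SeparatingRight := hright
    have hinj : Function.Injective (convForm k Λ).flip :=
      LinearMap.ker_eq_bot.mp (LinearMap.separatingRight_iff_flip_ker_eq_bot.mp hsep)
    have hsurj : Function.Surjective (convForm k Λ).flip :=
      (LinearMap.injective_iff_surjective_of_finrank_eq_finrank
        (Subspace.dual_finrank_eq (K := k) (V := H →ₗ[k] k)).symm).mp hinj
    intro φ hφ
    refine (Module.forall_dual_apply_eq_zero_iff k φ).mp fun f => ?_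
    obtain ⟨ψ, rfl⟩ := hsurj f
    exact hφ ψ
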